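/- arXiv:2502.02193 — 2 statements merged into one kernel-verified Lean document; each statement's English description precedes it below -/
import Mathlib

section
/- Let m and n be positive real numbers and define f(k) = (1 − exp(−k·n/m))^k for k > 0 (using the real power), and let k* = (m/n)·ln 2. Then f is strictly decreasing on the interval (0, k*]: for all real numbers k₁, k₂ with 0 < k₁ < k₂ ≤ k*, f(k₂) < f(k₁). -/
/-- On `(0, 1/2)`, `-x log x` exceeds its reflection at `1 - x`. -/
theorem negMulLog_one_sub_lt_negMulLog {q : ℝ} (hq : 0 < q) (hq' : q < 1 / 2) :
    Real.negMulLog (1 - q) < Real.negMulLog q := by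
  have h := strictConcaveOn_log_Ioi.slope_anti_adjacent (x := q) (y := 1 - q) (z := 1)
    hq (by norm_num) (by linarith) (by linarith)
  rw [div_lt_div_iff₀ (by linarith) (by linarith), Real.log_one] at h
  simp only [Real.negMulLog]
  linarith

theorem one_sub_exp_neg_pos {x : ℝ} (hx : 0 < x) : 0 < 1 - Real.exp (-x) := by
  simpa using hx

theorem strictAntiOn_mul_log_one_sub_exp_neg :
    StrictAntiOn (fun x : ℝ ↦ x * Real.log (1 - Real.exp (-x))) (Set.Ioc 0 (Real.log 2)) := by
  have hderiv : ∀ x : ℝ, 0 < x → HasDerivAt (fun x : ℝ ↦ x * Real.log (1 - Real.exp (-x)))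
      (Real.log (1 - Real.exp (-x)) + x * (Real.exp (-x) / (1 - Real.exp (-x)))) x := by
    intro x hx
    have h := (hasDerivAt_id x).mul
      ((((hasDerivAt_id x).neg.exp).const_sub 1).log (one_sub_exp_neg_pos hx).ne')
    refine (h.congr_deriv ?_ :)
    simp
  refine strictAntiOn_of_deriv_neg (convex_Ioc _ _)
    (fun x hx ↦ (hderiv x hx.1).continuousAt.continuousWithinAt) fun x hx ↦ ?_
  rw [interior_Ioc] at hx
  obtain ⟨hx0, hx2⟩ := hx
  rw [(hderiv x hx0).deriv]
  have hq := one_sub_exp_neg_pos hx0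
  have hexp : 1 / 2 < Real.exp (-x) := by
    rw [← Real.log_lt_iff_lt_exp (by norm_num), one_div, Real.log_inv]
    linarith
  have h := negMulLog_one_sub_lt_negMulLog hq (by linarith)
  simp only [Real.negMulLog, sub_sub_cancel, Real.log_exp] at h
  rw [← mul_div_assoc, ← lt_neg_iff_add_neg', div_lt_iff₀ hq]
  linarith

/-- The approximate false positive rate `f k = (1 - exp (-k*n/m)) ^ k` is
strictly decreasing on `(0, k*]` where `k* = (m/n) * ln 2`. -/
theorem fp_rate_strictAntiOn (m n : ℝ) (hm : 0 < m) (hn : 0 < n)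
    (k₁ k₂ : ℝ) (hk₁ : 0 < k₁) (h₁₂ : k₁ < k₂) (hk₂ : k₂ ≤ m / n * Real.log 2) :
    (1 - Real.exp (-k₂ * n / m)) ^ k₂ < (1 - Real.exp (-k₁ * n / m)) ^ k₁ := by
  have hc : 0 < n / m := div_pos hn hm
  have hk₂' : 0 < k₂ := hk₁.trans h₁₂
  have hlt : k₁ * (n / m) < k₂ * (n / m) := mul_lt_mul_of_pos_right h₁₂ hc
  have hle : k₂ * (n / m) ≤ Real.log 2 := by
    calc k₂ * (n / m) ≤ m / n * Real.log 2 * (n / m) := mul_le_mul_of_nonneg_right hk₂ hc.le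
      _ = Real.log 2 := by field_simp
  have h := strictAntiOn_mul_log_one_sub_exp_neg
    ⟨mul_pos hk₁ hc, hlt.le.trans hle⟩ ⟨mul_pos hk₂' hc, hle⟩ hlt
  have harg : ∀ k : ℝ, -k * n / m = -(k * (n / m)) := fun k ↦ by ring
  rw [harg, harg, Real.rpow_def_of_pos (one_sub_exp_neg_pos (mul_pos hk₂' hc)),
    Real.rpow_def_of_pos (one_sub_exp_neg_pos (mul_pos hk₁ hc)), Real.exp_lt_exp]
  refine lt_of_mul_lt_mul_right ?_ hc.le
  linarith
end

section
/- Let m and n be positive real numbers and define f(k) = (1 − exp(−k·n/m))^k for k > 0 (using the real power), and let k* = (m/n)·ln 2. Then f is strictly increasing on the interval [k*, ∞): for all real numbers k₁, k₂ with k* ≤ k₁ < k₂, f(k₁) < f(k₂). -/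
theorem log_div_one_sub_lt_log_div_one_sub {p q : ℝ} (hp : 0 < p) (hpq : p < q) (hq : q < 1) :
    Real.log p / (1 - p) < Real.log q / (1 - q) := by
  have h := strictConcaveOn_log_Ioi.secant_strict_mono (a := 1) (x := p) (y := q)
    (Set.mem_Ioi.2 one_pos) (Set.mem_Ioi.2 hp) (Set.mem_Ioi.2 (hp.trans hpq))
    (hpq.trans hq).ne hq.ne hpq
  rw [Real.log_one, sub_zero, sub_zero, ← neg_sub 1 q, ← neg_sub 1 p, div_neg, div_neg] at h
  linarith

theorem strictMonoOn_mul_log_one_sub_exp_neg :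
    StrictMonoOn (fun x : ℝ => x * Real.log (1 - Real.exp (-x))) (Set.Ici (Real.log 2)) := by
  have hlog : 0 < Real.log 2 := Real.log_pos one_lt_two
  have hder : ∀ x : ℝ, 0 < x → HasDerivAt (fun x : ℝ => x * Real.log (1 - Real.exp (-x)))
      (Real.log (1 - Real.exp (-x)) + x * (Real.exp (-x) / (1 - Real.exp (-x)))) x := by
    intro x hx
    have hp : Real.exp (-x) < 1 := Real.exp_lt_one_iff.2 (by linarith)
    have h := (hasDerivAt_id x).mul
      (((hasDerivAt_neg x).exp.const_sub 1).log (sub_pos.2 hp).ne')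
    convert! h using 1
    simp
  refine strictMonoOn_of_deriv_pos (convex_Ici _)
    (fun x hx => (hder x (hlog.trans_le hx)).continuousAt.continuousWithinAt) fun x hx => ?_
  rw [interior_Ici, Set.mem_Ioi] at hx
  have hx0 : 0 < x := hlog.trans hx
  rw [(hder x hx0).deriv]
  have hp0 : 0 < Real.exp (-x) := Real.exp_pos _
  have hp : Real.exp (-x) < 1 / 2 := by
    rw [← Real.lt_log_iff_exp_lt (by norm_num), one_div, Real.log_inv]
    linarith
  have h := log_div_one_sub_lt_log_div_one_sub hp0
    (show Real.exp (-x) < 1 - Real.exp (-x) by linarith) (by linarith)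
  rw [Real.log_exp, sub_sub_cancel, lt_div_iff₀ hp0] at h
  have e : -x / (1 - Real.exp (-x)) * Real.exp (-x)
      = -(x * (Real.exp (-x) / (1 - Real.exp (-x)))) := by ring
  linarith

/-- The approximate false positive rate `f k = (1 - exp (-k*n/m)) ^ k` is
strictly increasing on `[k*, ∞)` where `k* = (m/n) * ln 2`. -/
theorem fp_rate_strictMonoOn (m n : ℝ) (hm : 0 < m) (hn : 0 < n)
    (k₁ k₂ : ℝ) (hk₁ : m / n * Real.log 2 ≤ k₁) (h₁₂ : k₁ < k₂) :
    (1 - Real.exp (-k₁ * n / m)) ^ k₁ < (1 - Real.exp (-k₂ * n / m)) ^ k₂ := by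
  have hnm : 0 < n / m := div_pos hn hm
  have hlog : 0 < Real.log 2 := Real.log_pos one_lt_two
  have h₁ : Real.log 2 ≤ k₁ * (n / m) := by
    calc Real.log 2 = m / n * Real.log 2 * (n / m) := by field_simp
      _ ≤ k₁ * (n / m) := by gcongr
  have h₂ : k₁ * (n / m) < k₂ * (n / m) := by gcongr
  have hpos : ∀ k : ℝ, Real.log 2 ≤ k * (n / m) → 0 < 1 - Real.exp (-(k * (n / m))) :=
    fun k hk => sub_pos.2 (Real.exp_lt_one_iff.2 (by linarith))
  have h := strictMonoOn_mul_log_one_sub_exp_neg h₁ (h₁.trans h₂.le) h₂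
  have e : ∀ k : ℝ, -k * n / m = -(k * (n / m)) := fun k => by ring
  rw [e, e, Real.rpow_def_of_pos (hpos _ h₁), Real.rpow_def_of_pos (hpos _ (h₁.trans h₂.le)),
    Real.exp_lt_exp]
  refine lt_of_mul_lt_mul_right ?_ hnm.le
  linarith
end
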